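/- For each letter l ∈ {x₁, x₂, y₁, y₂} let c_l : A → A be the k-linear map defined on the basis ℬ by c_l(w) = u if the word w ∈ ℬ has the form w = l·u (then automatically u ∈ ℬ), and c_l(w) = 0 if w does not begin with l. Then for all a ∈ A: (0) a = ε_A(a)·1 + x₁c_{x₁}(a) + x₂c_{x₂}(a) + y₁c_{y₁}(a) + y₂c_{y₂}(a); (1) c_{x₁}(x₁a) = ε_A(a)·1 + x₁c_{x₁}(a) + y₁c_{y₁}(a); (2) c_{x₁}(x₂a) = 0; (3) c_{x₂}(x₁a) = 0; (4) c_{x₂}(x₂a) = ε_A(a)·1 + x₂c_{x₂}(a) + y₂c_{y₂}(a); (5) c_{y₁}(x₁a) = −(y₁ − 1)c_{x₂}(a) + x₁c_{y₂}(a); (6) c_{y₁}(x₂a) = 0; (7) c_{y₂}(x₁a) = 0; (8) c_{y₂}(x₂a) = −(y₂ − 1)c_{x₁}(a) + x₂c_{y₁}(a); (9) c_{y₁}(y₁a) = a and c_{y₂}(y₂a) = a; (10) c_l(y₁a) = 0 for l ≠ y₁ and c_l(y₂a) = 0 for l ≠ y₂. -/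

import Mathlib

noncomputable section

/-- The augmentation ideal of an augmented `k`-algebra, as a `k`-submodule. -/
def augIdeal {k A : Type*} [CommRing k] [Ring A] [Algebra k A] (ε : A →ₐ[k] k) :
    Submodule k A :=
  LinearMap.ker ε.toLinearMap

variable (k : Type*) [CommRing k]

/-- The generators `x₁, x₂, y₁, y₂` of the free algebra `F` on four generators:
`x₁ = Xg k 0`, `x₂ = Xg k 1`, `y₁ = Xg k 2`, `y₂ = Xg k 3`. -/
def Xg (i : Fin 4) : FreeAlgebra k (Fin 4) := FreeAlgebra.ι k i

/-- `r₁ = x₁x₂ + y₁² − y₁`. -/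
def r1 : FreeAlgebra k (Fin 4) := Xg k 0 * Xg k 1 + Xg k 2 * Xg k 2 - Xg k 2
/-- `r₂ = x₂x₁ + y₂² − y₂`. -/
def r2 : FreeAlgebra k (Fin 4) := Xg k 1 * Xg k 0 + Xg k 3 * Xg k 3 - Xg k 3
/-- `r₃ = x₁y₂ − y₁x₁`. -/
def r3 : FreeAlgebra k (Fin 4) := Xg k 0 * Xg k 3 - Xg k 2 * Xg k 0
/-- `r₄ = x₂y₁ − y₂x₂`. -/
def r4 : FreeAlgebra k (Fin 4) := Xg k 1 * Xg k 2 - Xg k 3 * Xg k 1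

/-- The relations of `B = F/(r₁, r₂)`. -/
def relB : FreeAlgebra k (Fin 4) → FreeAlgebra k (Fin 4) → Prop := fun a b =>
  (a = r1 k ∨ a = r2 k) ∧ b = 0

/-- The relations of `A = F/(r₁, r₂, r₃, r₄)`. -/
def relA : FreeAlgebra k (Fin 4) → FreeAlgebra k (Fin 4) → Prop := fun a b =>
  (a = r1 k ∨ a = r2 k ∨ a = r3 k ∨ a = r4 k) ∧ b = 0

/-- `B = F/(r₁, r₂)`. -/
def AlgB : Type _ := RingQuot (relB k)
/-- `A = F/(r₁, r₂, r₃, r₄)`. -/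
def AlgA : Type _ := RingQuot (relA k)

instance : Ring (AlgB k) := by unfold AlgB; infer_instance
instance : Algebra k (AlgB k) := by unfold AlgB; infer_instance
instance : Ring (AlgA k) := by unfold AlgA; infer_instance
instance : Algebra k (AlgA k) := by unfold AlgA; infer_instance

/-- The projection `F → B`. -/
def mkB : FreeAlgebra k (Fin 4) →ₐ[k] AlgB k := RingQuot.mkAlgHom k (relB k)
/-- The projection `F → A`. -/
def mkA : FreeAlgebra k (Fin 4) →ₐ[k] AlgA k := RingQuot.mkAlgHom k (relA k)

/-- The augmentation of `B`, sending every generator to `0`. -/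
def εB : AlgB k →ₐ[k] k :=
  RingQuot.liftAlgHom k
    ⟨FreeAlgebra.lift k (fun _ => (0 : k)), by
      rintro a b ⟨h, rfl⟩
      rcases h with rfl | rfl <;> simp [r1, r2, Xg]⟩

/-- The augmentation of `A`, sending every generator to `0`. -/
def εA : AlgA k →ₐ[k] k :=
  RingQuot.liftAlgHom k
    ⟨FreeAlgebra.lift k (fun _ => (0 : k)), by
      rintro a b ⟨h, rfl⟩
      rcases h with rfl | rfl | rfl | rfl <;> simp [r1, r2, r3, r4, Xg]⟩

/-- The element of `A` given by a word in the generators (the empty word giving `1`). -/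
def wordProdA (l : List (Fin 4)) : AlgA k := mkA k ((l.map (FreeAlgebra.ι k)).prod)

/-- A word (letters `0 = x₁`, `1 = x₂`, `2 = y₁`, `3 = y₂`) is good if it contains none of
`x₁x₂`, `x₂x₁`, `x₁y₂`, `x₂y₁` as a contiguous subword. -/
def GoodWord (l : List (Fin 4)) : Prop :=
  ¬ [0, 1] <:+: l ∧ ¬ [1, 0] <:+: l ∧ ¬ [0, 3] <:+: l ∧ ¬ [1, 2] <:+: l

theorem goodWord_nil : GoodWord [] := by
  simp [GoodWord]

theorem GoodWord.tail {l : Fin 4} {u : List (Fin 4)} (h : GoodWord (l :: u)) : GoodWord u := by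
  simp only [GoodWord, List.infix_cons_iff, not_or] at h ⊢
  tauto

theorem GoodWord.cons_y {p : Fin 4} (hp : p = 2 ∨ p = 3) {u : List (Fin 4)} (h : GoodWord u) :
    GoodWord (p :: u) := by
  rcases hp with rfl | rfl <;>
    simpa [GoodWord, List.infix_cons_iff, List.cons_prefix_cons] using h

/-- The letters `(i, j, p, q)` are `(x₁, x₂, y₁, y₂)` or, after exchanging the indices,
`(x₂, x₁, y₂, y₁)`. -/
def LetterFrame (i j p q : Fin 4) : Prop :=
  (i = 0 ∧ j = 1 ∧ p = 2 ∧ q = 3) ∨ (i = 1 ∧ j = 0 ∧ p = 3 ∧ q = 2)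

namespace LetterFrame

variable {i j p q : Fin 4}

theorem eq_or (h : LetterFrame i j p q) (b : Fin 4) : b = i ∨ b = j ∨ b = p ∨ b = q := by
  rcases h with ⟨rfl, rfl, rfl, rfl⟩ | ⟨rfl, rfl, rfl, rfl⟩ <;> fin_cases b <;> simp

theorem p_eq (h : LetterFrame i j p q) : p = 2 ∨ p = 3 := by
  rcases h with ⟨-, -, h, -⟩ | ⟨-, -, h, -⟩ <;> simp [h]

theorem goodWord_singleton (h : LetterFrame i j p q) : GoodWord [i] := by
  rcases h with ⟨rfl, rfl, rfl, rfl⟩ | ⟨rfl, rfl, rfl, rfl⟩ <;>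
    simp [GoodWord, List.infix_cons_iff, List.cons_prefix_cons]

theorem goodWord_cons_cons (h : LetterFrame i j p q) {b : Fin 4} (hb : b = i ∨ b = p)
    {u : List (Fin 4)} (hu : GoodWord (b :: u)) : GoodWord (i :: b :: u) := by
  rcases h with ⟨rfl, rfl, rfl, rfl⟩ | ⟨rfl, rfl, rfl, rfl⟩ <;> rcases hb with rfl | rfl <;>
    simpa [GoodWord, List.infix_cons_iff, List.cons_prefix_cons] using hu

end LetterFrame

section Generic

variable {k} {A : Type*} [Ring A] [Algebra k A]

/-- The product of a word in the elements `g 0, g 1, g 2, g 3`. -/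
def wordProd (g : Fin 4 → A) (w : List (Fin 4)) : A := (w.map g).prod

theorem wordProd_nil (g : Fin 4 → A) : wordProd g [] = 1 := rfl

theorem wordProd_cons (g : Fin 4 → A) (l : Fin 4) (u : List (Fin 4)) :
    wordProd g (l :: u) = g l * wordProd g u := by
  simp [wordProd]

/-- The elements `g 0, g 1, g 2, g 3` satisfy the defining relations of `A`. -/
structure LetterRelations (g : Fin 4 → A) : Prop where
  x_mul_x {i j p q : Fin 4} (h : LetterFrame i j p q) : g i * g j = g p - g p * g p
  x_mul_y {i j p q : Fin 4} (h : LetterFrame i j p q) : g i * g q = g p * g i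

variable (k) in
/-- The `k`-submodule spanned by the good words in `g`. -/
def goodSpan (g : Fin 4 → A) : Submodule k A :=
  Submodule.span k (wordProd g '' {w | GoodWord w})

variable {g : Fin 4 → A}

theorem wordProd_mem_goodSpan {w : List (Fin 4)} (h : GoodWord w) :
    wordProd g w ∈ goodSpan k g :=
  Submodule.subset_span ⟨w, h, rfl⟩

theorem mul_mem_goodSpan_of_forall {b : A}
    (hb : ∀ w, GoodWord w → b * wordProd g w ∈ goodSpan k g) {a : A} (ha : a ∈ goodSpan k g) :
    b * a ∈ goodSpan k g := by
  have : goodSpan k g ≤ (goodSpan k g).comap (LinearMap.mulLeft k b) := by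
    refine Submodule.span_le.2 ?_
    rintro _ ⟨w, hw, rfl⟩
    exact hb w hw
  exact this ha

theorem y_mul_mem_goodSpan {p : Fin 4} (hp : p = 2 ∨ p = 3) {a : A} (ha : a ∈ goodSpan k g) :
    g p * a ∈ goodSpan k g :=
  mul_mem_goodSpan_of_forall (fun w hw => by
    rw [← wordProd_cons]
    exact wordProd_mem_goodSpan (hw.cons_y hp)) ha

namespace LetterRelations

theorem x_mul_wordProd_mem_goodSpan (hg : LetterRelations g) {i j p q : Fin 4}
    (h : LetterFrame i j p q) (w : List (Fin 4)) (hw : GoodWord w) :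
    g i * wordProd g w ∈ goodSpan k g := by
  induction w with
  | nil =>
    rw [← wordProd_cons]
    exact wordProd_mem_goodSpan h.goodWord_singleton
  | cons b u ih =>
    have hu := wordProd_mem_goodSpan (k := k) (g := g) hw.tail
    obtain hb | hb | hb | hb := h.eq_or b
    · rw [← wordProd_cons]
      exact wordProd_mem_goodSpan (h.goodWord_cons_cons (.inl hb) hw)
    · rw [hb, wordProd_cons, ← mul_assoc, hg.x_mul_x h, sub_mul, mul_assoc]
      exact sub_mem (y_mul_mem_goodSpan h.p_eq hu)
        (y_mul_mem_goodSpan h.p_eq (y_mul_mem_goodSpan h.p_eq hu))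
    · rw [← wordProd_cons]
      exact wordProd_mem_goodSpan (h.goodWord_cons_cons (.inr hb) hw)
    · rw [hb, wordProd_cons, ← mul_assoc, hg.x_mul_y h, mul_assoc]
      exact y_mul_mem_goodSpan h.p_eq (ih hw.tail)

theorem generator_mul_mem_goodSpan (hg : LetterRelations g) (l : Fin 4) {a : A}
    (ha : a ∈ goodSpan k g) : g l * a ∈ goodSpan k g := by
  have h₁ : LetterFrame 0 1 2 3 := by simp [LetterFrame]
  have h₂ : LetterFrame 1 0 3 2 := by simp [LetterFrame]
  obtain rfl | rfl | hl := h₁.eq_or l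
  · exact mul_mem_goodSpan_of_forall (hg.x_mul_wordProd_mem_goodSpan h₁) ha
  · exact mul_mem_goodSpan_of_forall (hg.x_mul_wordProd_mem_goodSpan h₂) ha
  · exact y_mul_mem_goodSpan hl ha

theorem goodSpan_eq_top (hg : LetterRelations g)
    (hgen : Function.Surjective (FreeAlgebra.lift k g)) : goodSpan k g = ⊤ := by
  have key (f : FreeAlgebra k (Fin 4)) :
      ∀ a ∈ goodSpan k g, FreeAlgebra.lift k g f * a ∈ goodSpan k g := by
    induction f using FreeAlgebra.induction with
    | grade0 r =>
      intro a ha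
      rw [AlgHom.commutes, ← Algebra.smul_def]
      exact Submodule.smul_mem _ _ ha
    | grade1 l =>
      intro a ha
      rw [FreeAlgebra.lift_ι_apply]
      exact hg.generator_mul_mem_goodSpan l ha
    | mul f₁ f₂ h₁ h₂ =>
      intro a ha
      rw [map_mul, mul_assoc]
      exact h₁ _ (h₂ _ ha)
    | add f₁ f₂ h₁ h₂ =>
      intro a ha
      rw [map_add, add_mul]
      exact add_mem (h₁ _ ha) (h₂ _ ha)
  refine Submodule.eq_top_iff'.2 fun a => ?_
  obtain ⟨f, rfl⟩ := hgen a
  simpa using key f 1 (wordProd_nil g ▸ wordProd_mem_goodSpan goodWord_nil)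

end LetterRelations

theorem linearMap_ext_goodWord (hspan : goodSpan k g = ⊤) {f₁ f₂ : A →ₗ[k] A}
    (h : ∀ w, GoodWord w → f₁ (wordProd g w) = f₂ (wordProd g w)) : f₁ = f₂ := by
  refine LinearMap.ext_on hspan ?_
  rintro _ ⟨w, hw, rfl⟩
  exact h w hw

/-- The linear map `c l` strips the letter `l` from the front of good words. -/
structure IsLetterStrip (g : Fin 4 → A) (c : Fin 4 → A →ₗ[k] A) : Prop where
  map_one (l : Fin 4) : c l 1 = 0
  map_cons (l b : Fin 4) (u : List (Fin 4)) (h : GoodWord (b :: u)) :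
    c l (wordProd g (b :: u)) = if b = l then wordProd g u else 0

namespace IsLetterStrip

variable {c : Fin 4 → A →ₗ[k] A} {ε : A →ₐ[k] k}

theorem y_mul (hc : IsLetterStrip g c) (hspan : goodSpan k g = ⊤) {p : Fin 4}
    (hp : p = 2 ∨ p = 3) (l : Fin 4) (a : A) : c l (g p * a) = if p = l then a else 0 := by
  have : c l ∘ₗ LinearMap.mulLeft k (g p) = if p = l then LinearMap.id else 0 := by
    refine linearMap_ext_goodWord hspan fun w hw => ?_
    rw [LinearMap.comp_apply, LinearMap.mulLeft_apply, ← wordProd_cons,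
      hc.map_cons l p w (hw.cons_y hp)]
    split_ifs <;> rfl
  have := LinearMap.congr_fun this a
  split_ifs at this ⊢ <;> simpa using this

/-- The value of `c l` on `x_i a`, for all letters `l` at once. -/
theorem x_mul (hc : IsLetterStrip g c) (hg : LetterRelations g) (hspan : goodSpan k g = ⊤)
    (hε : ∀ l, ε (g l) = 0) {i j p q : Fin 4} (h : LetterFrame i j p q) (l : Fin 4) (a : A) :
    c l (g i * a) =
      (if i = l then algebraMap k A (ε a) + g i * c i a + g p * c p a else 0) +
      (if p = l then -((g p - 1) * c j a) + g i * c q a else 0) := by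
  have : c l ∘ₗ LinearMap.mulLeft k (g i) =
      (if i = l then Algebra.linearMap k A ∘ₗ ε.toLinearMap
        + LinearMap.mulLeft k (g i) ∘ₗ c i + LinearMap.mulLeft k (g p) ∘ₗ c p else 0) +
      (if p = l then -(LinearMap.mulLeft k (g p - 1) ∘ₗ c j)
        + LinearMap.mulLeft k (g i) ∘ₗ c q else 0) := by
    refine linearMap_ext_goodWord hspan fun w hw => ?_
    have hp := h.p_eq
    obtain ⟨hij, hip, hiq, hji, hjp, hjq, hpi, hpj, hpq, hqi, hqj, hqp⟩ :
        i ≠ j ∧ i ≠ p ∧ i ≠ q ∧ j ≠ i ∧ j ≠ p ∧ j ≠ q ∧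
          p ≠ i ∧ p ≠ j ∧ p ≠ q ∧ q ≠ i ∧ q ≠ j ∧ q ≠ p := by
      rcases h with ⟨rfl, rfl, rfl, rfl⟩ | ⟨rfl, rfl, rfl, rfl⟩ <;> decide
    rw [LinearMap.comp_apply, LinearMap.mulLeft_apply]
    cases w with
    | nil =>
      rw [← wordProd_cons, hc.map_cons l i [] h.goodWord_singleton]
      split_ifs <;> simp_all [wordProd_nil, hc.map_one]
    | cons b u =>
      have hcb (l : Fin 4) := hc.map_cons l b u hw
      have hεb : ε (wordProd g (b :: u)) = 0 := by
        rw [wordProd_cons, map_mul, hε, zero_mul]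
      obtain rfl | rfl | rfl | rfl := h.eq_or b
      · rw [← wordProd_cons, hc.map_cons l _ _ (h.goodWord_cons_cons (.inl rfl) hw)]
        split_ifs <;> simp_all [wordProd_cons]
      · have hw' : g i * wordProd g (b :: u) = g p * wordProd g u - g p * (g p * wordProd g u) := by
          rw [wordProd_cons, ← mul_assoc, hg.x_mul_x h, sub_mul, mul_assoc]
        rw [hw', map_sub, hc.y_mul hspan hp, hc.y_mul hspan hp]
        split_ifs <;> simp_all [sub_mul]
      · rw [← wordProd_cons, hc.map_cons l _ _ (h.goodWord_cons_cons (.inr rfl) hw)]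
        split_ifs <;> simp_all [wordProd_cons]
      · have hw' : g i * wordProd g (b :: u) = g p * (g i * wordProd g u) := by
          rw [wordProd_cons, ← mul_assoc, hg.x_mul_y h, mul_assoc]
        rw [hw', hc.y_mul hspan hp]
        split_ifs <;> simp_all
  have := LinearMap.congr_fun this a
  split_ifs at this ⊢ <;> simpa using this

theorem eq_sum (hc : IsLetterStrip g c) (hspan : goodSpan k g = ⊤) (hε : ∀ l, ε (g l) = 0)
    (a : A) : a = algebraMap k A (ε a) + ∑ l, g l * c l a := by
  have : LinearMap.id = Algebra.linearMap k A ∘ₗ ε.toLinearMap +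
      ∑ l, LinearMap.mulLeft k (g l) ∘ₗ c l := by
    refine linearMap_ext_goodWord hspan fun w hw => ?_
    cases w with
    | nil => simp [wordProd_nil, hc.map_one]
    | cons b u =>
      have hεb : ε (wordProd g (b :: u)) = 0 := by
        rw [wordProd_cons, map_mul, hε, zero_mul]
      simpa [hc.map_cons _ b u hw, hεb] using wordProd_cons g b u
  simpa using LinearMap.congr_fun this a

end IsLetterStrip

/-- The identities of `c_maps_identities` in any algebra generated by elements satisfying the
relations of `A`. -/
theorem IsLetterStrip.identities {c : Fin 4 → A →ₗ[k] A} {ε : A →ₐ[k] k}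
    (hc : IsLetterStrip g c) (hg : LetterRelations g)
    (hgen : Function.Surjective (FreeAlgebra.lift k g)) (hε : ∀ l, ε (g l) = 0) (a : A) :
    (a = algebraMap k A (ε a)
          + g 0 * c 0 a + g 1 * c 1 a
          + g 2 * c 2 a + g 3 * c 3 a)
      ∧ (c 0 (g 0 * a) = algebraMap k A (ε a)
          + g 0 * c 0 a + g 2 * c 2 a)
      ∧ (c 0 (g 1 * a) = 0)
      ∧ (c 1 (g 0 * a) = 0)
      ∧ (c 1 (g 1 * a) = algebraMap k A (ε a)
          + g 1 * c 1 a + g 3 * c 3 a)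
      ∧ (c 2 (g 0 * a) =
          -((g 2 - 1) * c 1 a) + g 0 * c 3 a)
      ∧ (c 2 (g 1 * a) = 0)
      ∧ (c 3 (g 0 * a) = 0)
      ∧ (c 3 (g 1 * a) =
          -((g 3 - 1) * c 0 a) + g 1 * c 2 a)
      ∧ (c 2 (g 2 * a) = a)
      ∧ (c 3 (g 3 * a) = a)
      ∧ (∀ l : Fin 4, l ≠ 2 → c l (g 2 * a) = 0)
      ∧ (∀ l : Fin 4, l ≠ 3 → c l (g 3 * a) = 0) := by
  have hspan := hg.goodSpan_eq_top hgen
  have hx₁ := hc.x_mul hg hspan hε (i := 0) (j := 1) (p := 2) (q := 3) (by simp [LetterFrame])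
  have hx₂ := hc.x_mul hg hspan hε (i := 1) (j := 0) (p := 3) (q := 2) (by simp [LetterFrame])
  have hy₁ := hc.y_mul hspan (p := 2) (.inl rfl)
  have hy₂ := hc.y_mul hspan (p := 3) (.inr rfl)
  refine ⟨?_, ?_, ?_, ?_, ?_, ?_, ?_, ?_, ?_, ?_, ?_, ?_, ?_⟩
  · simpa [Fin.sum_univ_four, add_assoc] using hc.eq_sum hspan hε a
  · simpa using hx₁ 0 a
  · simpa using hx₂ 0 a
  · simpa using hx₁ 1 a
  · simpa using hx₂ 1 a
  · simpa using hx₁ 2 a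
  · simpa using hx₂ 2 a
  · simpa using hx₁ 3 a
  · simpa using hx₂ 3 a
  · simpa using hy₁ 2 a
  · simpa using hy₂ 3 a
  · exact fun l hl => (hy₁ l a).trans (if_neg hl.symm)
  · exact fun l hl => (hy₂ l a).trans (if_neg hl.symm)

end Generic

theorem mkA_eq_zero {r : FreeAlgebra k (Fin 4)}
    (h : r = r1 k ∨ r = r2 k ∨ r = r3 k ∨ r = r4 k) : mkA k r = 0 := by
  have := RingQuot.mkAlgHom_rel k (s := relA k) (x := r) (y := 0) ⟨h, rfl⟩
  exact this.trans (map_zero (mkA k))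

theorem LetterFrame.mkA_x_mul_x {i j p q : Fin 4} (h : LetterFrame i j p q) :
    mkA k (Xg k i) * mkA k (Xg k j) =
      mkA k (Xg k p) - mkA k (Xg k p) * mkA k (Xg k p) := by
  rcases h with ⟨rfl, rfl, rfl, rfl⟩ | ⟨rfl, rfl, rfl, rfl⟩
  · have := mkA_eq_zero k (r := r1 k) (by simp)
    rw [r1, map_sub, map_add, map_mul, map_mul, sub_eq_zero] at this
    exact eq_sub_of_add_eq this
  · have := mkA_eq_zero k (r := r2 k) (by simp)
    rw [r2, map_sub, map_add, map_mul, map_mul, sub_eq_zero] at this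
    exact eq_sub_of_add_eq this

theorem LetterFrame.mkA_x_mul_y {i j p q : Fin 4} (h : LetterFrame i j p q) :
    mkA k (Xg k i) * mkA k (Xg k q) = mkA k (Xg k p) * mkA k (Xg k i) := by
  rcases h with ⟨rfl, rfl, rfl, rfl⟩ | ⟨rfl, rfl, rfl, rfl⟩
  · have := mkA_eq_zero k (r := r3 k) (by simp)
    rwa [r3, map_sub, map_mul, map_mul, sub_eq_zero] at this
  · have := mkA_eq_zero k (r := r4 k) (by simp)
    rwa [r4, map_sub, map_mul, map_mul, sub_eq_zero] at this

theorem εA_mkA_Xg (l : Fin 4) : εA k (mkA k (Xg k l)) = 0 := by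
  have h : εA k (mkA k (Xg k l)) = FreeAlgebra.lift k (fun _ => (0 : k)) (Xg k l) :=
    RingQuot.liftAlgHom_mkAlgHom_apply k _ _ _
  simpa [Xg] using h

theorem wordProdA_eq_wordProd (w : List (Fin 4)) :
    wordProdA k w = wordProd (fun l => mkA k (Xg k l)) w := by
  simp only [wordProdA, wordProd, map_list_prod, List.map_map]
  rfl

theorem letterRelations_mkA : LetterRelations fun l => mkA k (Xg k l) :=
  ⟨LetterFrame.mkA_x_mul_x k, LetterFrame.mkA_x_mul_y k⟩

theorem lift_mkA_surjective :
    Function.Surjective (FreeAlgebra.lift k fun l => mkA k (Xg k l)) := by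
  have : FreeAlgebra.lift k (fun l => mkA k (Xg k l)) = mkA k :=
    FreeAlgebra.hom_ext (by ext l; simp [Xg])
  rw [this]
  exact RingQuot.mkAlgHom_surjective k (relA k)

/-- Let `c l : A → A` (for each letter `l`) be the `k`-linear maps determined on the basis
of good words by `c l (l·u) = u` and `c l w = 0` if `w` does not begin with `l`
(letters `0 = x₁`, `1 = x₂`, `2 = y₁`, `3 = y₂`).  Then the stated identities
(0)–(10) hold for every `a ∈ A`. -/
theorem c_maps_identities
    (c : Fin 4 → AlgA k →ₗ[k] AlgA k)
    (hc1 : ∀ (l : Fin 4) (u : List (Fin 4)), GoodWord (l :: u) →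
      c l (wordProdA k (l :: u)) = wordProdA k u)
    (hc2 : ∀ (l : Fin 4) (w : List (Fin 4)), GoodWord w → (∀ u : List (Fin 4), w ≠ l :: u) →
      c l (wordProdA k w) = 0) :
    ∀ a : AlgA k,
      (a = algebraMap k (AlgA k) (εA k a)
          + mkA k (Xg k 0) * c 0 a + mkA k (Xg k 1) * c 1 a
          + mkA k (Xg k 2) * c 2 a + mkA k (Xg k 3) * c 3 a)
      ∧ (c 0 (mkA k (Xg k 0) * a) = algebraMap k (AlgA k) (εA k a)
          + mkA k (Xg k 0) * c 0 a + mkA k (Xg k 2) * c 2 a)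
      ∧ (c 0 (mkA k (Xg k 1) * a) = 0)
      ∧ (c 1 (mkA k (Xg k 0) * a) = 0)
      ∧ (c 1 (mkA k (Xg k 1) * a) = algebraMap k (AlgA k) (εA k a)
          + mkA k (Xg k 1) * c 1 a + mkA k (Xg k 3) * c 3 a)
      ∧ (c 2 (mkA k (Xg k 0) * a) =
          -((mkA k (Xg k 2) - 1) * c 1 a) + mkA k (Xg k 0) * c 3 a)
      ∧ (c 2 (mkA k (Xg k 1) * a) = 0)
      ∧ (c 3 (mkA k (Xg k 0) * a) = 0)
      ∧ (c 3 (mkA k (Xg k 1) * a) =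
          -((mkA k (Xg k 3) - 1) * c 0 a) + mkA k (Xg k 1) * c 2 a)
      ∧ (c 2 (mkA k (Xg k 2) * a) = a)
      ∧ (c 3 (mkA k (Xg k 3) * a) = a)
      ∧ (∀ l : Fin 4, l ≠ 2 → c l (mkA k (Xg k 2) * a) = 0)
      ∧ (∀ l : Fin 4, l ≠ 3 → c l (mkA k (Xg k 3) * a) = 0) := by
  have hc : IsLetterStrip (fun l => mkA k (Xg k l)) c := by
    refine ⟨fun l => ?_, fun l b u hw => ?_⟩
    · rw [← wordProd_nil fun l => mkA k (Xg k l), ← wordProdA_eq_wordProd]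
      exact hc2 l [] goodWord_nil (by simp)
    · rw [← wordProdA_eq_wordProd, ← wordProdA_eq_wordProd]
      split_ifs with h
      · subst h
        exact hc1 b u hw
      · exact hc2 l _ hw (by simp [h])
  exact hc.identities (letterRelations_mkA k) (lift_mkA_surjective k) (εA_mkA_Xg k)
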